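/- arXiv:1212.1564 — 3 statements merged into one kernel-verified Lean document; each statement's English description precedes it below -/
import Mathlib

section
/- For all natural numbers x and y, C(x+y, x)² ≤ C(2x, x) · C(2y, y). -/
/-- Vandermonde's identity in symmetric form: `C(x+y, x) = ∑ i, C(x, i) C(y, i)`. -/
theorem add_choose_eq_sum_choose_mul_choose (x y : ℕ) :
    (x + y).choose x = ∑ i ∈ Finset.range (x + 1), x.choose i * y.choose i := by
  rw [Nat.add_comm x y, Nat.add_choose_eq, Finset.Nat.sum_antidiagonal_eq_sum_range_succ_mk]
  refine Finset.sum_congr rfl fun i hi => ?_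
  rw [Nat.choose_symm (Finset.mem_range_succ_iff.mp hi), mul_comm]

/-- Cauchy–Schwarz bound for the binomial kernel `K(x,y) = C(x+y,x)`:
`C(x+y, x)² ≤ C(2x, x) · C(2y, y)`. -/
theorem binomial_kernel_cauchy_schwarz (x y : ℕ) :
    ((x + y).choose x) ^ 2 ≤ (2 * x).choose x * (2 * y).choose y := by
  wlog hxy : x ≤ y generalizing x y
  · rw [Nat.choose_symm_add, Nat.add_comm x y, mul_comm ((2 * x).choose x)]
    exact this y x (Nat.le_of_not_le hxy)
  rw [add_choose_eq_sum_choose_mul_choose, ← Nat.sum_range_choose_sq x,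
    ← Nat.sum_range_choose_sq y]
  refine (Finset.sum_mul_sq_le_sq_mul_sq _ _ _).trans (Nat.mul_le_mul_left _ ?_)
  exact Finset.sum_le_sum_of_subset (Finset.range_mono (Nat.succ_le_succ hxy))
end

section
/- Let g : ℕ → ℝ be finitely supported. Then ∑_{n=0}^{∞} ( ∑_{x=n}^{∞} C(x,n) g(x) )² = ∑_{x=0}^{∞} ∑_{y=0}^{∞} g(x) g(y) C(x+y, x). That is, the transform g ↦ g^▽, g^▽(n) = ∑_{x=n}^{∞} C(x,n) g(x), is an isometry from the form with kernel K(x,y) = C(x+y,x) into ℓ²(ℤ₊). (All sums are finite because g has finite support.) -/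
/-- Vandermonde's identity in symmetric form, summed over any range exceeding `x`. -/
theorem sum_range_choose_mul_choose_of_lt {x N : ℕ} (y : ℕ) (hx : x < N) :
    ∑ n ∈ Finset.range N, x.choose n * y.choose n = (x + y).choose x := by
  rw [Nat.add_comm x y, Nat.add_choose_eq, Finset.Nat.sum_antidiagonal_eq_sum_range_succ_mk]
  symm
  refine Finset.sum_subset_zero_on_sdiff (Finset.range_mono hx) (fun n hn => ?_) fun n hn => ?_
  · rw [Finset.mem_sdiff, Finset.mem_range, Finset.mem_range] at hn
    rw [Nat.choose_eq_zero_of_lt (by omega), zero_mul]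
  · rw [Finset.mem_range] at hn
    rw [Nat.choose_symm (by omega), mul_comm]

/-- For finitely supported `g : ℕ → ℝ`,
`∑_n (∑_{x=n}^∞ C(x,n) g(x))² = ∑_x ∑_y g(x) g(y) C(x+y,x)`:
the transform `g ↦ g^▽` is an isometry from the form with kernel `K(x,y) = C(x+y,x)`
into `ℓ²(ℤ₊)`. All sums are finite because `g` has finite support. -/
theorem second_transform_isometry (g : ℕ → ℝ)
    (hg : Set.Finite (Function.support g)) :
    (∑' n : ℕ, (∑' x : ℕ, (x.choose n : ℝ) * g x) ^ 2) =
      ∑' x : ℕ, ∑' y : ℕ, g x * g y * ((x + y).choose x : ℝ) := by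
  obtain ⟨B, hB⟩ := hg.bddAbove
  have hzero : ∀ x ∉ Finset.range (B + 1), g x = 0 := fun x hx => by
    by_contra h
    exact hx (Finset.mem_range.2 (Nat.lt_succ_of_le (hB h)))
  have htransform (n : ℕ) : (∑' x : ℕ, (x.choose n : ℝ) * g x) =
      ∑ x ∈ Finset.range (B + 1), (x.choose n : ℝ) * g x :=
    tsum_eq_sum fun x hx => by rw [hzero x hx, mul_zero]
  have hkernel (x : ℕ) : (∑' y : ℕ, g x * g y * ((x + y).choose x : ℝ)) =
      ∑ y ∈ Finset.range (B + 1), g x * g y * ((x + y).choose x : ℝ) :=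
    tsum_eq_sum fun y hy => by rw [hzero y hy, mul_zero, zero_mul]
  simp only [htransform, hkernel]
  rw [tsum_eq_sum (s := Finset.range (B + 1)), tsum_eq_sum (s := Finset.range (B + 1))]
  · simp only [sq, Finset.sum_mul_sum]
    rw [Finset.sum_comm]
    refine Finset.sum_congr rfl fun x hx => ?_
    rw [Finset.sum_comm]
    refine Finset.sum_congr rfl fun y _ => ?_
    rw [← sum_range_choose_mul_choose_of_lt y (Finset.mem_range.1 hx), Nat.cast_sum,
      Finset.mul_sum]
    refine Finset.sum_congr rfl fun n _ => ?_
    push_cast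
    ring
  · intro x hx
    simp [hzero x hx]
  · intro n hn
    rw [Finset.sum_eq_zero, zero_pow two_ne_zero]
    intro x hx
    rw [Finset.mem_range] at hn hx
    rw [Nat.choose_eq_zero_of_lt (by omega), Nat.cast_zero, zero_mul]
end

section
/- For every real number a and every x ∈ ℕ, the series ∑_{y=x}^{∞} (-1)^{x+y} C(y,x) a^y / y! converges with sum e^{-a} · a^x / x!. That is, the function g_a(y) = a^y / y! satisfies g_a^△ = e^{-a} · g_a, where f^△(x) = ∑_{y=x}^{∞} (-1)^{x+y} C(y,x) f(y). -/
/-- For every real `a` and every `x ∈ ℕ`, the series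
`∑_{y=x}^∞ (-1)^(x+y) C(y,x) a^y / y!` converges with sum `e^{-a} · a^x / x!`;
that is, `g_a^△ = e^{-a} g_a` for `g_a(y) = a^y / y!`. (Terms with `y < x` vanish
since `C(y,x) = 0`.) -/
theorem second_transform_of_exponential (a : ℝ) (x : ℕ) :
    HasSum (fun y : ℕ =>
        (-1 : ℝ) ^ (x + y) * (y.choose x : ℝ) * (a ^ y / (Nat.factorial y : ℝ)))
      (Real.exp (-a) * (a ^ x / (Nat.factorial x : ℝ))) := by
  have h := (NormedSpace.expSeries_div_hasSum_exp (-a)).mul_right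
    (a ^ x / (Nat.factorial x : ℝ))
  rw [← Real.exp_eq_exp_ℝ] at h
  refine ((add_left_injective x).hasSum_iff fun y hy => ?_).mp ?_
  · have hyx : y < x := by
      by_contra! hle
      exact hy ⟨y - x, Nat.sub_add_cancel hle⟩
    simp [Nat.choose_eq_zero_of_lt hyx]
  · convert! h using 2 with n
    have hsign : (-1 : ℝ) ^ (x + (n + x)) = (-1) ^ n := by
      rw [show x + (n + x) = n + 2 * x by ring, pow_add, pow_mul]
      norm_num
    have hchoose : ((n + x).choose x : ℝ) =
        (Nat.factorial (n + x) : ℝ) / (Nat.factorial n * Nat.factorial x) := by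
      rw [Nat.cast_choose ℝ (Nat.le_add_left x n), Nat.add_sub_cancel, mul_comm (x.factorial : ℝ)]
    have hn : (Nat.factorial n : ℝ) ≠ 0 := by positivity
    have hx : (Nat.factorial x : ℝ) ≠ 0 := by positivity
    have hnx : (Nat.factorial (n + x) : ℝ) ≠ 0 := by positivity
    simp only [Function.comp_apply]
    rw [hsign, hchoose, neg_pow a n, pow_add]
    field_simp
end
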